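/- arXiv:2308.08152 — 4 statements merged into one kernel-verified Lean document; each statement's English description precedes it below -/
import Mathlib

section
/- Suppose T_F = T_E (so T = 2·T_E), longitudinal surrogacy holds at time T_E, and comparability holds. Then the average effect of the long-term treatment satisfies τ_T = Σ_{x ∈ 𝕏} Σ_{s₀ ∈ 𝕊} Σ_{s ∈ 𝕊} [ h_{T_E}(s, x, 1)·p_{T_E}(s₀, s; x, 1) − h_{T_E}(s, x, 0)·p_{T_E}(s₀, s; x, 0) ]·P(X = x, S_0 = s₀). -/
open MeasureTheory ProbabilityTheory

lemma integral_cond_eq {Ω : Type*} [MeasurableSpace Ω] (μ : Measure Ω) (B : Set Ω) (f : Ω → ℝ) :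
    ∫ ω, f ω ∂(μ[|B]) = (μ.real B)⁻¹ * ∫ ω in B, f ω ∂μ := by
  rw [ProbabilityTheory.cond, integral_smul_measure]
  simp [Measure.real]

lemma setIntegral_eq_sum_inter_fiber {Ω ι : Type*} [MeasurableSpace Ω] [Fintype ι]
    (μ : Measure Ω) {B : Set Ω} (hB : MeasurableSet B) (g : Ω → ι)
    (hg : ∀ i, MeasurableSet (g ⁻¹' {i})) {f : Ω → ℝ} (hf : Integrable f μ) :
    ∫ ω in B, f ω ∂μ = ∑ i, ∫ ω in B ∩ g ⁻¹' {i}, f ω ∂μ := by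
  have hU : B = ⋃ i, B ∩ g ⁻¹' {i} := by ext; simp
  conv_lhs => rw [hU]
  refine integral_iUnion_fintype (fun i => hB.inter (hg i)) ?_ (fun i => hf.integrableOn)
  intro i j hij
  refine Set.disjoint_left.2 fun ω hi hj => hij ?_
  exact hi.2.symm.trans hj.2

/-- If the conditional mean of `f` is the same constant `m` on every non-null cell of a finite
measurable partition of `B`, then `∫_B f = μ(B) m`. -/
lemma setIntegral_eq_of_cond_fiber {Ω ι : Type*} [MeasurableSpace Ω] [Fintype ι]
    (μ : Measure Ω) [IsFiniteMeasure μ] {B : Set Ω} (hB : MeasurableSet B) (g : Ω → ι)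
    (hg : ∀ i, MeasurableSet (g ⁻¹' {i})) {f : Ω → ℝ} (hf : Integrable f μ) (m : ℝ)
    (hm : ∀ i, μ (B ∩ g ⁻¹' {i}) ≠ 0 → ∫ ω, f ω ∂(μ[|B ∩ g ⁻¹' {i}]) = m) :
    ∫ ω in B, f ω ∂μ = μ.real B * m := by
  have hconst := setIntegral_eq_sum_inter_fiber μ hB g hg (integrable_const m)
  rw [setIntegral_const, smul_eq_mul] at hconst
  rw [hconst, setIntegral_eq_sum_inter_fiber μ hB g hg hf]
  refine Finset.sum_congr rfl fun i _ => ?_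
  rw [setIntegral_const, smul_eq_mul]
  by_cases h0 : μ (B ∩ g ⁻¹' {i}) = 0
  · rw [setIntegral_measure_zero _ h0]
    simp [Measure.real, h0]
  · rw [← hm i h0, integral_cond_eq, mul_inv_cancel_left₀]
    exact (measureReal_ne_zero_iff).2 h0

/-- Expectations of the first coordinate agree when the joint laws do. -/
lemma integral_eq_of_map_prodMk_eq {Ω β : Type*} [MeasurableSpace Ω] [MeasurableSpace β]
    {μ ν : Measure Ω} {f f' : Ω → ℝ} {g g' : Ω → β} (hf : Measurable f) (hf' : Measurable f')
    (hg : Measurable g) (hg' : Measurable g')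
    (hmap : μ.map (fun ω => (f ω, g ω)) = ν.map (fun ω => (f' ω, g' ω))) :
    ∫ ω, f ω ∂μ = ∫ ω, f' ω ∂ν := by
  have hfst := congrArg (fun ρ : Measure (ℝ × β) => ∫ z, z.1 ∂ρ) hmap
  simpa only [integral_map (hf.prodMk hg).aemeasurable measurable_fst.aestronglyMeasurable,
    integral_map (hf'.prodMk hg').aemeasurable measurable_fst.aestronglyMeasurable] using hfst

/-- Lemma 1 (special case `T_F = T_E`): under longitudinal surrogacy at time `T_E`
and comparability, the average effect of the long-term treatment is identified by
the surrogate index and the transition probabilities. -/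
theorem longterm_effect_special_case
    {Ω : Type*} [MeasurableSpace Ω] (P : Measure Ω) [IsProbabilityMeasure P]
    {𝕏 : Type*} [Fintype 𝕏] [MeasurableSpace 𝕏] [MeasurableSingletonClass 𝕏]
    (D T_E T_F : ℕ) (hD : 0 < D) (hTE : 0 < T_E) (hTF : 0 < T_F)
    (hTFE : T_F = T_E)
    (𝕊 : Finset (Fin D → ℝ))
    (X : Ω → 𝕏) (hX : Measurable X)
    (S : ℕ → Ω → (Fin D → ℝ)) (hSmeas : ∀ t, Measurable (S t))
    (hSmem : ∀ t ω, S t ω ∈ 𝕊)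
    (Y : ℕ → Ω → ℝ) (hYmeas : ∀ t, Measurable (Y t)) (hYint : ∀ t, Integrable (Y t) P)
    (A : Ω → Bool) (hA : Measurable A)
    -- randomized assignment: `A` is independent of `(X, S_0)`
    (hindep : IndepFun (fun ω => (X ω, S 0 ω)) A P)
    -- all conditioning events have positive probability
    (hApos : ∀ a : Bool, P {ω | A ω = a} ≠ 0)
    (hpos : ∀ r, r ≤ T_E + T_F → ∀ s ∈ 𝕊, ∀ (x : 𝕏) (a : Bool),
      P {ω | S r ω = s ∧ X ω = x ∧ A ω = a} ≠ 0)
    -- longitudinal surrogacy at time `T_E`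
    (hsurr : ∀ t, T_E < t → t ≤ T_E + T_F →
      ∀ s ∈ 𝕊, ∀ (x : 𝕏) (a : Bool) (hist : ℕ → (Fin D → ℝ)),
        P {ω | (∀ i < T_E, S i ω = hist i) ∧ S T_E ω = s ∧ X ω = x ∧ A ω = a} ≠ 0 →
        Measure.map (fun ω => (Y t ω, S t ω))
            (P[|{ω | (∀ i < T_E, S i ω = hist i) ∧ S T_E ω = s ∧ X ω = x ∧ A ω = a}])
          = Measure.map (fun ω => (Y t ω, S t ω))
            (P[|{ω | S T_E ω = s ∧ X ω = x ∧ A ω = a}]))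
    -- comparability
    (hcomp : ∀ r t r' t', r < t → t ≤ T_E + T_F → r' < t' → t' ≤ T_E + T_F →
      t - r = t' - r' → ∀ s ∈ 𝕊, ∀ (x : 𝕏) (a : Bool),
        Measure.map (fun ω => (Y t ω, S t ω)) (P[|{ω | S r ω = s ∧ X ω = x ∧ A ω = a}])
          = Measure.map (fun ω => (Y t' ω, S t' ω)) (P[|{ω | S r' ω = s ∧ X ω = x ∧ A ω = a}]))
    -- the surrogate index
    (h : ℕ → (Fin D → ℝ) → 𝕏 → Bool → ℝ)
    (hdef : ∀ t s x a,
      h t s x a = ∫ ω, Y t ω ∂(P[|{ω | S 0 ω = s ∧ X ω = x ∧ A ω = a}]))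
    -- the transition probabilities
    (p : ℕ → (Fin D → ℝ) → (Fin D → ℝ) → 𝕏 → Bool → ℝ)
    (pdef : ∀ t s s' x a,
      p t s s' x a = ((P[|{ω | S 0 ω = s ∧ X ω = x ∧ A ω = a}]) {ω | S t ω = s'}).toReal) :
    (∫ ω, Y (T_E + T_F) ω ∂(P[|{ω | A ω = true}]))
      - (∫ ω, Y (T_E + T_F) ω ∂(P[|{ω | A ω = false}]))
    = ∑ x : 𝕏, ∑ s₀ ∈ 𝕊, ∑ s ∈ 𝕊,
        (h T_E s x true * p T_E s₀ s x true - h T_E s x false * p T_E s₀ s x false)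
          * (P {ω | X ω = x ∧ S 0 ω = s₀}).toReal := by
  subst hTFE
  have hXm : ∀ x, MeasurableSet {ω | X ω = x} := fun x => hX (measurableSet_singleton x)
  have hAm : ∀ a, MeasurableSet {ω | A ω = a} := fun a => hA (measurableSet_singleton a)
  have hSm : ∀ t s, MeasurableSet {ω | S t ω = s} := fun t s =>
    hSmeas t (measurableSet_singleton s)
  have hfactor : ∀ s₀ x a, P.real {ω | S 0 ω = s₀ ∧ X ω = x ∧ A ω = a}
      = P.real {ω | X ω = x ∧ S 0 ω = s₀} * P.real {ω | A ω = a} := by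
    intro s₀ x a
    have hI := hindep.measure_inter_preimage_eq_mul {(x, s₀)} {a}
      (measurableSet_singleton _) (measurableSet_singleton a)
    rw [Measure.real, Measure.real, Measure.real, ← ENNReal.toReal_mul]
    congr 1
    convert hI using 2
    · ext ω; simp; tauto
    · have hpre : {ω | X ω = x ∧ S 0 ω = s₀} = (fun ω => (X ω, S 0 ω)) ⁻¹' {(x, s₀)} := by
        ext ω; simp
      rw [hpre]
    · rfl
  have hcell : ∀ s ∈ 𝕊, ∀ s₀ x a,
      ∫ ω in {ω | S T_F ω = s ∧ S 0 ω = s₀ ∧ X ω = x ∧ A ω = a}, Y (T_F + T_F) ω ∂P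
        = P.real {ω | S T_F ω = s ∧ S 0 ω = s₀ ∧ X ω = x ∧ A ω = a} * h T_F s x a := by
    intro s hs s₀ x a
    refine setIntegral_eq_of_cond_fiber P
      (B := {ω | S T_F ω = s ∧ S 0 ω = s₀ ∧ X ω = x ∧ A ω = a})
      ((hSm _ _).inter ((hSm _ _).inter ((hXm _).inter (hAm _))))
      (fun ω => fun i : Fin T_F => (⟨S i ω, hSmem i ω⟩ : 𝕊)) (fun k => ?_) (hYint _) _
      (fun k hk => ?_)
    · have : (fun ω => fun i : Fin T_F => (⟨S i ω, hSmem i ω⟩ : 𝕊)) ⁻¹' {k}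
          = ⋂ i : Fin T_F, {ω | S i ω = k i} := by
        ext ω; simp [funext_iff, Subtype.ext_iff]
      rw [this]
      exact MeasurableSet.iInter fun i => hSm _ _
    · obtain ⟨ω₀, ⟨-, hω₀, -, -⟩, hk₀⟩ := nonempty_of_measure_ne_zero hk
      have hset : {ω | S T_F ω = s ∧ S 0 ω = s₀ ∧ X ω = x ∧ A ω = a} ∩
          (fun ω => fun i : Fin T_F => (⟨S i ω, hSmem i ω⟩ : 𝕊)) ⁻¹' {k}
          = {ω | (∀ i < T_F, S i ω = S i ω₀) ∧ S T_F ω = s ∧ X ω = x ∧ A ω = a} := by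
        obtain rfl : (fun i : Fin T_F => (⟨S i ω₀, hSmem i ω₀⟩ : 𝕊)) = k := hk₀
        ext ω
        simp only [Set.mem_inter_iff, Set.mem_ofPred_eq, Set.mem_preimage, Set.mem_singleton_iff]
        constructor
        · rintro ⟨⟨h1, -, h2, h3⟩, h4⟩
          exact ⟨fun i hi => congrArg Subtype.val (congrFun h4 ⟨i, hi⟩), h1, h2, h3⟩
        · rintro ⟨h4, h1, h2, h3⟩
          exact ⟨⟨h1, (h4 0 hTF).trans hω₀, h2, h3⟩, funext fun i => Subtype.ext (h4 i i.2)⟩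
      rw [hset] at hk ⊢
      rw [hdef]
      refine integral_eq_of_map_prodMk_eq (hYmeas _) (hYmeas _) (hSmeas _) (hSmeas _)
        ((hsurr (T_F + T_F) (by omega) le_rfl s hs x a (fun i => S i ω₀) hk).trans
          (hcomp T_F (T_F + T_F) 0 T_F (by omega) le_rfl hTF (by omega) (by omega) s hs x a))
  have harm : ∀ a, ∫ ω, Y (T_F + T_F) ω ∂(P[|{ω | A ω = a}])
      = ∑ x : 𝕏, ∑ s₀ ∈ 𝕊, ∑ s ∈ 𝕊, h T_F s x a * p T_F s₀ s x a
          * P.real {ω | X ω = x ∧ S 0 ω = s₀} := by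
    intro a
    have hsplit := setIntegral_eq_sum_inter_fiber P (hAm a)
      (fun ω => (X ω, (⟨S 0 ω, hSmem 0 ω⟩ : 𝕊), (⟨S T_F ω, hSmem T_F ω⟩ : 𝕊)))
      (fun k => by
        convert (hXm k.1).inter ((hSm 0 k.2.1).inter (hSm T_F k.2.2)) using 1
        ext ω; simp [Prod.ext_iff, Subtype.ext_iff]) (hYint (T_F + T_F))
    rw [integral_cond_eq, hsplit, Fintype.sum_prod_type, Finset.mul_sum]
    refine Finset.sum_congr rfl fun x _ => ?_
    rw [Fintype.sum_prod_type, Finset.mul_sum, ← Finset.sum_coe_sort 𝕊]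
    refine Finset.sum_congr rfl fun s₀ _ => ?_
    rw [Finset.mul_sum, ← Finset.sum_coe_sort 𝕊]
    refine Finset.sum_congr rfl fun s _ => ?_
    have hset : {ω | A ω = a} ∩
        (fun ω => (X ω, (⟨S 0 ω, hSmem 0 ω⟩ : 𝕊), (⟨S T_F ω, hSmem T_F ω⟩ : 𝕊))) ⁻¹' {(x, s₀, s)}
        = {ω | S T_F ω = s ∧ S 0 ω = s₀ ∧ X ω = x ∧ A ω = a} := by
      ext ω; simp [Subtype.ext_iff]; tauto
    have hB : MeasurableSet {ω | S 0 ω = (s₀ : Fin D → ℝ) ∧ X ω = x ∧ A ω = a} :=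
      (hSm _ _).inter ((hXm _).inter (hAm _))
    have hinter : {ω | S 0 ω = (s₀ : Fin D → ℝ) ∧ X ω = x ∧ A ω = a} ∩ {ω | S T_F ω = s}
        = {ω | S T_F ω = s ∧ S 0 ω = s₀ ∧ X ω = x ∧ A ω = a} := by
      ext ω; simp; tauto
    have hne : P.real {ω | S 0 ω = (s₀ : Fin D → ℝ) ∧ X ω = x ∧ A ω = a} ≠ 0 :=
      (measureReal_ne_zero_iff (measure_ne_top _ _)).2 (hpos 0 (Nat.zero_le _) s₀ s₀.2 x a)
    rw [hset, hcell s s.2, pdef, cond_apply hB, hinter, ENNReal.toReal_mul, ENNReal.toReal_inv]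
    simp only [← measureReal_def]
    rw [hfactor] at hne ⊢
    have h1 := left_ne_zero_of_mul hne
    have h2 := right_ne_zero_of_mul hne
    field_simp
  rw [harm, harm]
  simp only [← Finset.sum_sub_distrib, sub_mul, Measure.real]
end

section
/- Let 𝕋 = {t_1 < t_2 < ⋯ < t_K} ⊆ {1,…,T}, set t_0 = 0, t_{K+1} = T and Δ_k = t_k − t_{k−1} for k = 1,…,K+1. Suppose longitudinal surrogacy holds at every time r ∈ 𝕋, comparability holds, and linearity of surrogates holds. Then the average effect of the long-term treatment satisfies τ_T = E[ h_{Δ_{K+1}}( g_{Δ_K}( ⋯ g_{Δ_2}( g_{Δ_1}(S_0, X, 1), X, 1) ⋯, X, 1), X, 1) ] − E[ h_{Δ_{K+1}}( g_{Δ_K}( ⋯ g_{Δ_2}( g_{Δ_1}(S_0, X, 0), X, 0) ⋯, X, 0), X, 0) ], where the expectations are taken over (S_0, X) and the compositions use the affine extensions of the surrogate and pivot indices. -/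
open MeasureTheory ProbabilityTheory

lemma integral_cond_eq_inv_mul_setIntegral {Ω : Type*} [MeasurableSpace Ω] {P : Measure Ω}
    (f : Ω → ℝ) (E : Set Ω) : ∫ ω, f ω ∂(P[|E]) = (P E)⁻¹.toReal * ∫ ω in E, f ω ∂P := by
  rw [ProbabilityTheory.cond, integral_smul_measure, smul_eq_mul]

/-- Two integrable functions with the same conditional mean on every non-null cell of a finite
partition of `E` have the same conditional mean on `E`. -/
lemma integral_cond_congr_of_finite_partition {Ω ι : Type*} [MeasurableSpace Ω] {P : Measure Ω}
    [IsFiniteMeasure P] [Finite ι] [MeasurableSpace ι] [MeasurableSingletonClass ι]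
    {H : Ω → ι} (hH : Measurable H) {f g : Ω → ℝ} (hf : Integrable f P) (hg : Integrable g P)
    {E : Set Ω} (hE : MeasurableSet E)
    (h : ∀ i, P (E ∩ H ⁻¹' {i}) ≠ 0 →
      ∫ ω, f ω ∂(P[|E ∩ H ⁻¹' {i}]) = ∫ ω, g ω ∂(P[|E ∩ H ⁻¹' {i}])) :
    ∫ ω, f ω ∂(P[|E]) = ∫ ω, g ω ∂(P[|E]) := by
  have := Fintype.ofFinite ι
  have hcell : ∀ i, MeasurableSet (E ∩ H ⁻¹' {i}) := fun i =>
    hE.inter (hH (measurableSet_singleton i))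
  have hdisj : Pairwise (Function.onFun Disjoint fun i => E ∩ H ⁻¹' {i}) := by
    intro i j hij
    refine Set.disjoint_left.2 fun ω hi hj => hij ?_
    exact hi.2.symm.trans hj.2
  have hunion : E = ⋃ i, E ∩ H ⁻¹' {i} := by ext ω; simp
  have hset : ∫ ω in E, f ω ∂P = ∫ ω in E, g ω ∂P := by
    rw [hunion, integral_iUnion_fintype hcell hdisj fun i => hf.integrableOn,
      integral_iUnion_fintype hcell hdisj fun i => hg.integrableOn]
    refine Finset.sum_congr rfl fun i _ => ?_
    by_cases h0 : P (E ∩ H ⁻¹' {i}) = 0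
    · rw [setIntegral_measure_zero _ h0, setIntegral_measure_zero _ h0]
    · have hi := h i h0
      rw [integral_cond_eq_inv_mul_setIntegral, integral_cond_eq_inv_mul_setIntegral] at hi
      refine mul_left_cancel₀ ?_ hi
      exact ENNReal.toReal_ne_zero.2
        ⟨ENNReal.inv_ne_zero.2 (measure_ne_top _ _), ENNReal.inv_ne_top.2 h0⟩
  rw [integral_cond_eq_inv_mul_setIntegral, integral_cond_eq_inv_mul_setIntegral, hset]

lemma integral_cond_eq_of_forall_mem {Ω : Type*} [MeasurableSpace Ω] {P : Measure Ω}
    [IsFiniteMeasure P] {E : Set Ω} (hE : MeasurableSet E) (h0 : P E ≠ 0) {f : Ω → ℝ} {c : ℝ}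
    (hf : ∀ ω ∈ E, f ω = c) : ∫ ω, f ω ∂(P[|E]) = c := by
  have := cond_isProbabilityMeasure h0
  have hae : f =ᵐ[P[|E]] fun _ => c := (ae_cond_mem hE).mono hf
  rw [integral_congr_ae hae]
  simp

lemma integrable_comp_of_mem_finset {Ω α : Type*} [MeasurableSpace Ω] {P : Measure Ω}
    [IsFiniteMeasure P] [MeasurableSpace α] [MeasurableSingletonClass α] {𝕊 : Finset α}
    {Z : Ω → α} (hZ : Measurable Z) (hmem : ∀ ω, Z ω ∈ 𝕊) (φ : α → ℝ) :
    Integrable (fun ω => φ (Z ω)) P := by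
  have hZ' : Measurable fun ω => (⟨Z ω, hmem ω⟩ : 𝕊) := hZ.subtype_mk
  exact (Integrable.of_finite (μ := P.map fun ω => (⟨Z ω, hmem ω⟩ : 𝕊))
    (f := fun s : 𝕊 => φ s)).comp_measurable hZ'

lemma integrable_cond {Ω : Type*} [MeasurableSpace Ω] {P : Measure Ω} {f : Ω → ℝ}
    (hf : Integrable f P) {E : Set Ω} (h0 : P E ≠ 0) : Integrable f (P[|E]) :=
  hf.integrableOn.smul_measure (ENNReal.inv_ne_top.2 h0)

/-- Conditioning on an event of a variable independent of a finitely supported `Z` does not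
change expectations of functions of `Z`. -/
lemma integral_comp_cond_eq_of_indepFun {Ω α β : Type*} [MeasurableSpace Ω] {P : Measure Ω}
    [IsProbabilityMeasure P] [MeasurableSpace α] [MeasurableSingletonClass α]
    [MeasurableSpace β] {s : Set α} (hs : s.Finite) {Z : Ω → α} {A : Ω → β}
    (hZ : Measurable Z) (hmem : ∀ ω, Z ω ∈ s) (hA : Measurable A) (hindep : IndepFun Z A P)
    {B : Set β} (hB : MeasurableSet B) (h0 : P (A ⁻¹' B) ≠ 0) (φ : α → ℝ) :
    ∫ ω, φ (Z ω) ∂(P[|A ⁻¹' B]) = ∫ ω, φ (Z ω) ∂P := by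
  have := hs.to_subtype
  have hZ' : Measurable fun ω => (⟨Z ω, hmem ω⟩ : s) := hZ.subtype_mk
  have hmap : (P[|A ⁻¹' B]).map (fun ω => (⟨Z ω, hmem ω⟩ : s))
      = P.map fun ω => (⟨Z ω, hmem ω⟩ : s) := by
    ext T hT
    rw [Measure.map_apply hZ' hT, Measure.map_apply hZ' hT, cond_apply (hA hB)]
    have hpre : (fun ω => (⟨Z ω, hmem ω⟩ : s)) ⁻¹' T = Z ⁻¹' (Subtype.val '' T) := by
      ext ω
      simp [hmem ω]
    rw [hpre, Set.inter_comm, hindep.measure_inter_preimage_eq_mul _ _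
      ((Set.toFinite _).measurableSet) hB, mul_comm, mul_assoc,
      ENNReal.mul_inv_cancel h0 (measure_ne_top _ _), mul_one]
  have hmeas : StronglyMeasurable fun z : s => φ z := .of_discrete
  have h1 := integral_map (μ := P[|A ⁻¹' B]) hZ'.aemeasurable hmeas.aestronglyMeasurable
  have h2 := integral_map (μ := P) hZ'.aemeasurable hmeas.aestronglyMeasurable
  rw [hmap] at h1
  exact h1.symm.trans h2

/-- If the mean of `W` given the past of `S` up to time `n` and `E` is `φ (S n)`, then `W` and
`φ (S n)` have the same mean given `S 0` and `E`. -/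
lemma integral_cond_eq_integral_cond_comp_of_surrogate {Ω α : Type*} [MeasurableSpace Ω]
    {P : Measure Ω} [IsFiniteMeasure P] [MeasurableSpace α] [MeasurableSingletonClass α]
    {𝕊 : Finset α} {S : ℕ → Ω → α} (hS : ∀ t, Measurable (S t)) (hmem : ∀ t ω, S t ω ∈ 𝕊)
    {E : Set Ω} (hE : MeasurableSet E) {W : Ω → ℝ} (hW : Integrable W P) (n : ℕ) (φ : α → ℝ)
    (h : ∀ s ∈ 𝕊, ∀ hist : ℕ → α,
      P {ω | (∀ i < n, S i ω = hist i) ∧ S n ω = s ∧ ω ∈ E} ≠ 0 →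
      ∫ ω, W ω ∂(P[|{ω | (∀ i < n, S i ω = hist i) ∧ S n ω = s ∧ ω ∈ E}]) = φ s) (s₀ : α) :
    ∫ ω, W ω ∂(P[|{ω | S 0 ω = s₀ ∧ ω ∈ E}])
      = ∫ ω, φ (S n ω) ∂(P[|{ω | S 0 ω = s₀ ∧ ω ∈ E}]) := by
  have hH : Measurable fun ω => fun i : Fin (n + 1) => (⟨S i ω, hmem i ω⟩ : 𝕊) :=
    measurable_pi_lambda _ fun i => (hS i).subtype_mk
  have hB : MeasurableSet {ω | S 0 ω = s₀ ∧ ω ∈ E} :=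
    (hS 0 (measurableSet_singleton s₀)).inter hE
  refine integral_cond_congr_of_finite_partition hH hW
    (integrable_comp_of_mem_finset (hS n) (hmem n) φ) hB fun i hi => ?_
  have hcell := hB.inter (hH (measurableSet_singleton i))
  obtain ⟨ω₀, ⟨hω₀, hω₀E⟩, hω₀i⟩ := nonempty_of_measure_ne_zero hi
  have hi' : ∀ j (hj : j < n + 1), S j ω₀ = i ⟨j, hj⟩ := fun j hj => by
    rw [← (show _ = i from hω₀i)]
  have hset : {ω | S 0 ω = s₀ ∧ ω ∈ E} ∩
      (fun ω => fun i : Fin (n + 1) => (⟨S i ω, hmem i ω⟩ : 𝕊)) ⁻¹' {i}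
      = {ω | (∀ j < n, S j ω = S j ω₀) ∧ S n ω = S n ω₀ ∧ ω ∈ E} := by
    ext ω
    simp only [Set.mem_inter_iff, Set.mem_ofPred_eq, Set.mem_preimage, Set.mem_singleton_iff]
    constructor
    · rintro ⟨⟨-, hωE⟩, hω⟩
      have key : ∀ j < n + 1, S j ω = S j ω₀ := fun j hj => by
        rw [hi' j hj, ← hω]
      exact ⟨fun j hj => key j (by omega), key n (by omega), hωE⟩
    · rintro ⟨h1, h2, hωE⟩
      have key : ∀ j < n + 1, S j ω = S j ω₀ := fun j hj => by
        rcases Nat.lt_succ_iff_lt_or_eq.1 hj with hj | rfl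
        · exact h1 j hj
        · exact h2
      refine ⟨⟨(key 0 (by omega)).trans hω₀, hωE⟩, ?_⟩
      funext j
      exact Subtype.ext ((key j j.2).trans (hi' j j.2))
  rw [hset] at hi hcell ⊢
  rw [h _ (hmem n ω₀) _ hi,
    integral_cond_eq_of_forall_mem hcell hi fun ω hω => congrArg φ hω.2.1]

lemma integral_eq_of_affine {Ω ι : Type*} [MeasurableSpace Ω] [Fintype ι] {Q : Measure Ω}
    [IsProbabilityMeasure Q] {Z : Ω → ι → ℝ} (hZ : ∀ d, Integrable (fun ω => Z ω d) Q)
    {φ : (ι → ℝ) → ℝ} (hφ : ∃ (c₀ : ℝ) (c : ι → ℝ), ∀ v, φ v = c₀ + ∑ d, v d * c d) :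
    ∫ ω, φ (Z ω) ∂Q = φ fun d => ∫ ω, Z ω d ∂Q := by
  obtain ⟨c₀, c, hc⟩ := hφ
  simp only [hc]
  rw [integral_add (integrable_const _) (integrable_finsetSum _ fun d _ => (hZ d).mul_const _),
    integral_finsetSum _ fun d _ => (hZ d).mul_const _]
  simp [integral_mul_const]

/-- Theorem 2 (linear surrogate model): under longitudinal surrogacy at every time in
`𝕋`, comparability, and linearity of surrogates, the average effect of the long-term
treatment is identified by iterating the (affinely extended) pivot indices and
applying the (affinely extended) surrogate index at the end, in expectation over
`(S_0, X)`. -/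
theorem linear_surrogate_model
    {Ω : Type*} [MeasurableSpace Ω] (P : Measure Ω) [IsProbabilityMeasure P]
    {𝕏 : Type*} [Fintype 𝕏] [MeasurableSpace 𝕏] [MeasurableSingletonClass 𝕏]
    (D T_E T_F : ℕ) (hD : 0 < D) (hTE : 0 < T_E) (hTF : 0 < T_F)
    (𝕊 : Finset (Fin D → ℝ))
    (X : Ω → 𝕏) (hX : Measurable X)
    (S : ℕ → Ω → (Fin D → ℝ)) (hSmeas : ∀ t, Measurable (S t))
    (hSmem : ∀ t ω, S t ω ∈ 𝕊)
    (Y : ℕ → Ω → ℝ) (hYmeas : ∀ t, Measurable (Y t)) (hYint : ∀ t, Integrable (Y t) P)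
    (A : Ω → Bool) (hA : Measurable A)
    -- randomized assignment: `A` is independent of `(X, S_0)`
    (hindep : IndepFun (fun ω => (X ω, S 0 ω)) A P)
    -- all conditioning events have positive probability
    (hApos : ∀ a : Bool, P {ω | A ω = a} ≠ 0)
    (hpos : ∀ r, r ≤ T_E + T_F → ∀ s ∈ 𝕊, ∀ (x : 𝕏) (a : Bool),
      P {ω | S r ω = s ∧ X ω = x ∧ A ω = a} ≠ 0)
    -- the pivot times `t 0 = 0 < t 1 < … < t K < t (K+1) = T`
    (K : ℕ) (t : ℕ → ℕ)
    (ht0 : t 0 = 0) (htlast : t (K + 1) = T_E + T_F)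
    (htmono : ∀ k, k ≤ K → t k < t (k + 1))
    -- longitudinal surrogacy at every time `r ∈ 𝕋`
    (hsurr : ∀ k, 1 ≤ k → k ≤ K → ∀ t', t k < t' → t' ≤ T_E + T_F →
      ∀ s ∈ 𝕊, ∀ (x : 𝕏) (a : Bool) (hist : ℕ → (Fin D → ℝ)),
        P {ω | (∀ i < t k, S i ω = hist i) ∧ S (t k) ω = s ∧ X ω = x ∧ A ω = a} ≠ 0 →
        Measure.map (fun ω => (Y t' ω, S t' ω))
            (P[|{ω | (∀ i < t k, S i ω = hist i) ∧ S (t k) ω = s ∧ X ω = x ∧ A ω = a}])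
          = Measure.map (fun ω => (Y t' ω, S t' ω))
            (P[|{ω | S (t k) ω = s ∧ X ω = x ∧ A ω = a}]))
    -- comparability
    (hcomp : ∀ r u r' u', r < u → u ≤ T_E + T_F → r' < u' → u' ≤ T_E + T_F →
      u - r = u' - r' → ∀ s ∈ 𝕊, ∀ (x : 𝕏) (a : Bool),
        Measure.map (fun ω => (Y u ω, S u ω)) (P[|{ω | S r ω = s ∧ X ω = x ∧ A ω = a}])
          = Measure.map (fun ω => (Y u' ω, S u' ω)) (P[|{ω | S r' ω = s ∧ X ω = x ∧ A ω = a}]))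
    -- the affinely extended surrogate index: affine in the surrogates (linearity of
    -- surrogates), and agreeing on `𝕊` with the conditional expectation of `Y`
    (hL : ℕ → (Fin D → ℝ) → 𝕏 → Bool → ℝ)
    (hLaffine : ∀ u (x : 𝕏) (a : Bool), 1 ≤ u → u ≤ T_E + T_F →
      ∃ (c₀ : ℝ) (c : Fin D → ℝ), ∀ v : Fin D → ℝ,
        hL u v x a = c₀ + ∑ d, v d * c d)
    (hLagree : ∀ u, 1 ≤ u → u ≤ T_E + T_F → ∀ s ∈ 𝕊, ∀ (x : 𝕏) (a : Bool),
      hL u s x a = ∫ ω, Y u ω ∂(P[|{ω | S 0 ω = s ∧ X ω = x ∧ A ω = a}]))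
    -- the affinely extended pivot index: each coordinate affine in the surrogates,
    -- and agreeing on `𝕊` with the conditional expectation of `S`
    (gL : ℕ → (Fin D → ℝ) → 𝕏 → Bool → (Fin D → ℝ))
    (hgaffine : ∀ u (x : 𝕏) (a : Bool) (d : Fin D), 1 ≤ u → u ≤ T_E + T_F →
      ∃ (c₀ : ℝ) (c : Fin D → ℝ), ∀ v : Fin D → ℝ,
        gL u v x a d = c₀ + ∑ d', v d' * c d')
    (hgagree : ∀ u, 1 ≤ u → u ≤ T_E + T_F → ∀ s ∈ 𝕊, ∀ (x : 𝕏) (a : Bool) (d : Fin D),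
      gL u s x a d = ∫ ω, S u ω d ∂(P[|{ω | S 0 ω = s ∧ X ω = x ∧ A ω = a}])) :
    (∫ ω, Y (T_E + T_F) ω ∂(P[|{ω | A ω = true}]))
      - (∫ ω, Y (T_E + T_F) ω ∂(P[|{ω | A ω = false}]))
    = (∫ ω, hL (t (K + 1) - t K)
          (Nat.rec (motive := fun _ => Fin D → ℝ) (S 0 ω)
            (fun k ih => gL (t (k + 1) - t k) ih (X ω) true) K)
          (X ω) true ∂P)
      - ∫ ω, hL (t (K + 1) - t K)
          (Nat.rec (motive := fun _ => Fin D → ℝ) (S 0 ω)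
            (fun k ih => gL (t (k + 1) - t k) ih (X ω) false) K)
          (X ω) false ∂P := by
  have htle : ∀ k, k ≤ K + 1 → t k ≤ T_E + T_F := fun k hk => by
    induction hk using Nat.decreasingInduction with
    | self => exact htlast.le
    | of_succ k hk ih => exact (htmono k (by omega)).le.trans ih
  have hΔ : ∀ k ≤ K, 1 ≤ t (k + 1) - t k ∧ t (k + 1) - t k ≤ T_E + T_F := fun k hk => by
    have h1 := htmono k hk
    have h2 := htle (k + 1) (by omega)
    omega
  have hBmeas : ∀ (x : 𝕏) (a : Bool), MeasurableSet {ω | X ω = x ∧ A ω = a} := fun x a =>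
    (hX (measurableSet_singleton x)).inter (hA (measurableSet_singleton a))
  -- regression of any outcome at the next pivot time on the current surrogates
  have hstep : ∀ (F : ℝ × (Fin D → ℝ) → ℝ), Measurable F →
      (∀ u, Integrable (fun ω => F (Y u ω, S u ω)) P) →
      ∀ k ≤ K, ∀ (s₀ : Fin D → ℝ) (x : 𝕏) (a : Bool) (φ : (Fin D → ℝ) → ℝ),
      (∀ s ∈ 𝕊, φ s = ∫ ω, F (Y (t (k + 1) - t k) ω, S (t (k + 1) - t k) ω)
        ∂(P[|{ω | S 0 ω = s ∧ X ω = x ∧ A ω = a}])) →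
      ∫ ω, F (Y (t (k + 1)) ω, S (t (k + 1)) ω) ∂(P[|{ω | S 0 ω = s₀ ∧ X ω = x ∧ A ω = a}])
        = ∫ ω, φ (S (t k) ω) ∂(P[|{ω | S 0 ω = s₀ ∧ X ω = x ∧ A ω = a}]) := by
    intro F hF hFint k hk s₀ x a φ hφ
    have hmap : ∀ (Q : Measure Ω) u,
        ∫ z, F z ∂(Q.map fun ω => (Y u ω, S u ω)) = ∫ ω, F (Y u ω, S u ω) ∂Q := fun Q u =>
      integral_map ((hYmeas u).prodMk (hSmeas u)).aemeasurable
        hF.stronglyMeasurable.aestronglyMeasurable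
    refine integral_cond_eq_integral_cond_comp_of_surrogate hSmeas hSmem (hBmeas x a)
      (hFint _) (t k) φ (fun s hs hist h0 => ?_) s₀
    have hlaw : Measure.map (fun ω => (Y (t (k + 1)) ω, S (t (k + 1)) ω))
            (P[|{ω | (∀ i < t k, S i ω = hist i) ∧ S (t k) ω = s ∧ X ω = x ∧ A ω = a}])
          = Measure.map (fun ω => (Y (t (k + 1)) ω, S (t (k + 1)) ω))
            (P[|{ω | S (t k) ω = s ∧ X ω = x ∧ A ω = a}]) := by
      rcases Nat.eq_zero_or_pos k with rfl | hk0
      · simp [ht0]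
      · exact hsurr k hk0 hk _ (htmono k hk) (htle _ (by omega)) s hs x a hist h0
    have hc := hcomp (t k) (t (k + 1)) 0 (t (k + 1) - t k) (htmono k hk) (htle _ (by omega))
      (hΔ k hk).1 (hΔ k hk).2 (by omega) s hs x a
    rw [hφ s hs, ← hmap _ (t (k + 1) - t k), ← hc, ← hlaw, hmap]
    rfl
  have hSint : ∀ u d, Integrable (fun ω => S u ω d) P := fun u d =>
    integrable_comp_of_mem_finset (hSmeas u) (hSmem u) fun v => v d
  -- the iterated pivot index is the conditional mean of the surrogates at the pivot times
  have hpivot : ∀ s₀ ∈ 𝕊, ∀ (x : 𝕏) (a : Bool), ∀ k ≤ K,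
      Nat.rec (motive := fun _ => Fin D → ℝ) s₀
        (fun k ih => gL (t (k + 1) - t k) ih x a) k
      = fun d => ∫ ω, S (t k) ω d ∂(P[|{ω | S 0 ω = s₀ ∧ X ω = x ∧ A ω = a}]) := by
    intro s₀ hs₀ x a k
    have h0 := hpos 0 (Nat.zero_le _) s₀ hs₀ x a
    have := cond_isProbabilityMeasure h0
    induction k with
    | zero =>
      intro _
      funext d
      refine (integral_cond_eq_of_forall_mem
        ((hSmeas 0 (measurableSet_singleton s₀)).inter (hBmeas x a)) h0 fun ω hω => ?_).symm
      rw [ht0, show S 0 ω = s₀ from hω.1]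
      rfl
    | succ k ih =>
      intro hk
      funext d
      have hk' : k ≤ K := by omega
      have h1 := hstep (fun z => z.2 d) (by fun_prop) (fun u => hSint u d) k hk' s₀ x a
        (fun v => gL (t (k + 1) - t k) v x a d)
        (fun s hs => hgagree _ (hΔ k hk').1 (hΔ k hk').2 s hs x a d)
      refine Eq.trans ?_ h1.symm
      rw [integral_eq_of_affine (φ := fun v => gL (t (k + 1) - t k) v x a d)
        (fun d => integrable_cond (hSint _ d) h0)
        (hgaffine _ x a d (hΔ k hk').1 (hΔ k hk').2), ← ih hk']
  have harm : ∀ a : Bool, ∫ ω, Y (T_E + T_F) ω ∂(P[|{ω | A ω = a}])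
      = ∫ ω, hL (t (K + 1) - t K)
          (Nat.rec (motive := fun _ => Fin D → ℝ) (S 0 ω)
            (fun k ih => gL (t (k + 1) - t k) ih (X ω) a) K) (X ω) a ∂P := by
    intro a
    have hfin : (Set.univ ×ˢ (𝕊 : Set (Fin D → ℝ)) : Set (𝕏 × (Fin D → ℝ))).Finite :=
      Set.finite_univ.prod 𝕊.finite_toSet
    have hZ : Measurable fun ω => (X ω, S 0 ω) := hX.prodMk (hSmeas 0)
    have hZmem : ∀ ω, (X ω, S 0 ω) ∈ hfin.toFinset := fun ω => by simpa using hSmem 0 ω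
    let Φ : 𝕏 × (Fin D → ℝ) → ℝ := fun z => hL (t (K + 1) - t K)
      (Nat.rec (motive := fun _ => Fin D → ℝ) z.2
        (fun k ih => gL (t (k + 1) - t k) ih z.1 a) K) z.1 a
    refine Eq.trans ?_ (integral_comp_cond_eq_of_indepFun hfin hZ
      (fun ω => by simpa using hSmem 0 ω) hA hindep (measurableSet_singleton a) (hApos a) Φ)
    have hH : Measurable fun ω => (X ω, (⟨S 0 ω, hSmem 0 ω⟩ : 𝕊)) :=
      hX.prodMk (hSmeas 0).subtype_mk
    have hAmeas : MeasurableSet {ω | A ω = a} := hA (measurableSet_singleton a)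
    refine integral_cond_congr_of_finite_partition hH (hYint _)
      (integrable_comp_of_mem_finset hZ hZmem Φ) hAmeas ?_
    rintro ⟨x, s₀, hs₀⟩ -
    have hset : {ω | A ω = a} ∩ (fun ω => (X ω, (⟨S 0 ω, hSmem 0 ω⟩ : 𝕊))) ⁻¹' {(x, ⟨s₀, hs₀⟩)}
        = {ω | S 0 ω = s₀ ∧ X ω = x ∧ A ω = a} := by
      ext ω
      simp only [Set.mem_inter_iff, Set.mem_ofPred_eq, Set.mem_preimage, Set.mem_singleton_iff,
        Prod.mk.injEq, Subtype.mk.injEq]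
      tauto
    rw [hset]
    have h0 := hpos 0 (Nat.zero_le _) s₀ hs₀ x a
    have := cond_isProbabilityMeasure h0
    have h1 := hstep Prod.fst measurable_fst hYint K le_rfl s₀ x a
      (fun v => hL (t (K + 1) - t K) v x a)
      (fun s hs => hLagree _ (hΔ K le_rfl).1 (hΔ K le_rfl).2 s hs x a)
    rw [← htlast]
    refine (h1.trans ?_).trans (integral_cond_eq_of_forall_mem (c := Φ (x, s₀))
      ((hSmeas 0 (measurableSet_singleton s₀)).inter (hBmeas x a)) h0
      fun ω hω => by rw [show S 0 ω = s₀ from hω.1, show X ω = x from hω.2.1]).symm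
    simp only [Φ]
    rw [integral_eq_of_affine (φ := fun v => hL (t (K + 1) - t K) v x a)
      (fun d => integrable_cond (hSint _ d) h0)
      (hLaffine _ x a (hΔ K le_rfl).1 (hΔ K le_rfl).2), hpivot s₀ hs₀ x a K le_rfl]
  rw [harm true, harm false]
end

section
/- Let 𝕋 = {t_1 < ⋯ < t_K} ⊆ {1,…,T}, set t_0 = 0, t_{K+1} = T and Δ_k = t_k − t_{k−1}. Suppose longitudinal surrogacy holds at every r ∈ 𝕋; extended linearity holds (for all positive integers δ ≤ t ≤ T, x ∈ 𝕏, a ∈ {0,1}, the maps s ↦ h^δ_t(s, x, a) and s ↦ g^δ_t(s, x, a) agree on 𝕊 with affine maps ℝ^D → ℝ and ℝ^D → ℝ^D respectively, by which they are extended to ℝ^D; write h_u = h^u_u and g_u = g^u_u); extended-domain parallel trends holds: for all t, t′ ∈ {1,…,T}, every positive integer δ ≤ min(t, t′), all v_1, v_0 ∈ ℝ^D and x ∈ 𝕏, h^δ_t(v_1, x, 1) − h^δ_{t′}(v_1, x, 1) = h^δ_t(v_0, x, 0) − h^δ_{t′}(v_0, x, 0); and extended parallel trends holds: for every j ∈ {0,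 1, …, K−1}, all u_0, u_1, …, u_j ∈ {1,…,T}, all t, t′ ∈ {1,…,T}, every positive integer δ ≤ min(t, t′), all v_1, v_0 ∈ ℝ^D and x ∈ 𝕏, writing Φ_a(v) = h_{u_0}( g_{u_1}( ⋯ g_{u_j}(v, x, a) ⋯, x, a), x, a) (with Φ_a(v) = h_{u_0}(v, x, a) when j = 0, using the affine extensions), one has Φ_1(g^δ_t(v_1, x, 1)) − Φ_1(g^δ_{t′}(v_1, x, 1)) = Φ_0(g^δ_t(v_0, x, 0)) − Φ_0(g^δ_{t′}(v_0, x, 0)). Then the average effect of the long-term treatment satisfies τ_T = E[ h_{Δ_{K+1}}( g_{Δ_K}( ⋯ g_{Δ_1}(S_0, X, 1) ⋯, X, 1), X, 1) ] − E[ h_{Δ_{K+1}}( g_{Δ_K}( ⋯ g_{Δ_1}(S_0, X, 0) ⋯, X, 0), X, 0) ], where the expectations are over (S_0, X). -/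
open MeasureTheory ProbabilityTheory

/-- Apply a list of maps `g u` (for `u` running through the list, innermost last). -/
def applyChain {β : Type*} (g : ℕ → β → β) : List ℕ → β → β
  | [], v => v
  | u :: us, v => g u (applyChain g us v)

/-- The law of total expectation for a random variable `Z` with finitely many values, under a
conditional probability. -/
theorem integral_cond_eq_integral_comp {Ω E : Type*} [MeasurableSpace Ω] {P : Measure Ω}
    [IsFiniteMeasure P] [MeasurableSpace E] [MeasurableSingletonClass E]
    {f : Ω → ℝ} (hf : Integrable f P) {Z : Ω → E} (hZ : Measurable Z)
    {s : Finset E} (hs : ∀ ω, Z ω ∈ s) {B : Set Ω} (hB : MeasurableSet B) {L : E → ℝ}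
    (hL : ∀ z ∈ s, L z = ∫ ω, f ω ∂(P[|{ω | Z ω = z ∧ ω ∈ B}])) :
    ∫ ω, f ω ∂(P[|B]) = ∫ ω, L (Z ω) ∂(P[|B]) := by
  have hmeas : ∀ z, MeasurableSet {ω | Z ω = z ∧ ω ∈ B} := fun z =>
    (hZ (measurableSet_singleton z)).inter hB
  have hunion : B = ⋃ z ∈ s, {ω | Z ω = z ∧ ω ∈ B} := by
    ext ω
    simp [hs ω]
  have hdisj : Set.Pairwise (s : Set E)
      (Function.onFun Disjoint fun z => {ω | Z ω = z ∧ ω ∈ B}) := by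
    intro z _ z' _ hne
    refine Set.disjoint_left.2 ?_
    rintro ω ⟨rfl, _⟩ ⟨h, _⟩
    exact hne h
  have hconst : ∀ z, Set.EqOn (fun ω => L (Z ω)) (fun _ => L z) {ω | Z ω = z ∧ ω ∈ B} := by
    rintro z ω ⟨rfl, _⟩
    rfl
  simp only [ProbabilityTheory.cond, integral_smul_measure] at hL ⊢
  congr 1
  rw [hunion, integral_biUnion_finset _ (fun z _ => hmeas z) hdisj
      (fun z _ => hf.integrableOn),
    integral_biUnion_finset _ (fun z _ => hmeas z) hdisj (fun z _ =>
      (integrableOn_congr_fun (hconst z) (hmeas z)).2 (integrable_const _).integrableOn)]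
  refine Finset.sum_congr rfl fun z hz => ?_
  rw [setIntegral_congr_fun (hmeas z) (hconst z), setIntegral_const, hL z hz]
  by_cases h0 : P {ω | Z ω = z ∧ ω ∈ B} = 0
  · rw [Measure.restrict_eq_zero.2 h0]
    simp [Measure.real, h0]
  · have h1 : (P {ω | Z ω = z ∧ ω ∈ B}).toReal ≠ 0 :=
      ENNReal.toReal_ne_zero.2 ⟨h0, measure_ne_top _ _⟩
    simp only [Measure.real, ENNReal.toReal_inv, smul_eq_mul]
    field_simp

theorem MeasureTheory.Integrable.cond {Ω : Type*} [MeasurableSpace Ω] {P : Measure Ω}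
    {f : Ω → ℝ} (hf : Integrable f P) {B : Set Ω} (hB : P B ≠ 0) : Integrable f (P[|B]) :=
  hf.restrict.smul_measure (ENNReal.inv_ne_top.2 hB)

/-- An affine function commutes with taking expectations. -/
theorem integrable_and_integral_affine {Ω ι : Type*} [Fintype ι] [MeasurableSpace Ω]
    {μ : Measure Ω} [IsProbabilityMeasure μ] {f : (ι → ℝ) → ℝ} {c₀ : ℝ} {c : ι → ℝ}
    (hf : ∀ v, f v = c₀ + ∑ d, v d * c d) {V : Ω → ι → ℝ}
    (hV : ∀ d, Integrable (fun ω => V ω d) μ) :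
    Integrable (fun ω => f (V ω)) μ ∧ ∫ ω, f (V ω) ∂μ = f (fun d => ∫ ω, V ω d ∂μ) := by
  simp only [hf]
  have hsum : Integrable (fun ω => ∑ d, V ω d * c d) μ :=
    integrable_finsetSum _ fun d _ => (hV d).mul_const _
  refine ⟨(integrable_const _).add hsum, ?_⟩
  rw [integral_add (integrable_const _) hsum,
    integral_finsetSum _ fun d _ => (hV d).mul_const _]
  simp [integral_mul_const]

/-- Conditioning on an event determined by an independent variable does not change
expectations. -/
theorem integral_cond_eq_integral_of_indepFun {Ω E : Type*} [MeasurableSpace Ω] {P : Measure Ω}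
    [IsProbabilityMeasure P] [MeasurableSpace E] [MeasurableSingletonClass E]
    {W : Ω → ℝ} (hW : Measurable W) {A : Ω → E} (hA : Measurable A)
    (hind : IndepFun W A P) {a : E} (ha : P {ω | A ω = a} ≠ 0) :
    ∫ ω, W ω ∂(P[|{ω | A ω = a}]) = ∫ ω, W ω ∂P := by
  have hms : MeasurableSet {ω | A ω = a} := hA (measurableSet_singleton a)
  have hmap : Measure.map W (P[|{ω | A ω = a}]) = Measure.map W P := by
    ext s hs
    rw [Measure.map_apply hW hs, Measure.map_apply hW hs, cond_apply hms, Set.inter_comm]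
    have := hind.measure_inter_preimage_eq_mul s {a} hs (measurableSet_singleton a)
    rw [show A ⁻¹' {a} = {ω | A ω = a} from rfl] at this
    rw [this, mul_comm (P _), ← mul_assoc, ENNReal.inv_mul_cancel ha (measure_ne_top _ _),
      one_mul]
  have hid : ∀ μ : Measure Ω, ∫ y, id y ∂(Measure.map W μ) = ∫ ω, W ω ∂μ := fun μ =>
    integral_map hW.aemeasurable aestronglyMeasurable_id
  rw [← hid, hmap, hid]

theorem applyChain_concat {β : Type*} (g : ℕ → β → β) (us : List ℕ) (u : ℕ) (v : β) :
    applyChain g (us ++ [u]) v = applyChain g us (g u v) := by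
  induction us with
  | nil => rfl
  | cons w ws ih => simp [applyChain, ih]

/-- The composition `g (k - 1) ∘ ⋯ ∘ g 0`. -/
def iterComp {β : Type*} (g : ℕ → β → β) (k : ℕ) (v : β) : β :=
  Nat.rec (motive := fun _ => β) v (fun i w => g i w) k

/-- A composition of affine self-maps commutes with taking expectations. -/
theorem integrable_and_integral_iterComp {Ω ι : Type*} [Fintype ι] [MeasurableSpace Ω]
    {μ : Measure Ω} [IsProbabilityMeasure μ] {g : ℕ → (ι → ℝ) → (ι → ℝ)} {K : ℕ}
    (hg : ∀ k < K, ∀ d, ∃ (c₀ : ℝ) (c : ι → ℝ), ∀ v, g k v d = c₀ + ∑ d', v d' * c d')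
    {V : Ω → ι → ℝ} (hV : ∀ d, Integrable (fun ω => V ω d) μ) {k : ℕ} (hk : k ≤ K) :
    (∀ d, Integrable (fun ω => iterComp g k (V ω) d) μ) ∧
      (fun d => ∫ ω, iterComp g k (V ω) d ∂μ) = iterComp g k (fun d => ∫ ω, V ω d ∂μ) := by
  induction k with
  | zero => exact ⟨hV, rfl⟩
  | succ k ih =>
    obtain ⟨h1, h2⟩ := ih (by omega)
    have key : ∀ d, Integrable (fun ω => g k (iterComp g k (V ω)) d) μ ∧
        ∫ ω, g k (iterComp g k (V ω)) d ∂μ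
          = g k (fun d => ∫ ω, iterComp g k (V ω) d ∂μ) d := fun d => by
      obtain ⟨c₀, c, hc⟩ := hg k (by omega) d
      exact integrable_and_integral_affine (f := fun v => g k v d) hc h1
    refine ⟨fun d => (key d).1, funext fun d => (key d).2.trans ?_⟩
    rw [h2]
    rfl

theorem measurable_of_affine {ι : Type*} [Fintype ι] {f : (ι → ℝ) → ℝ} {c₀ : ℝ} {c : ι → ℝ}
    (hf : ∀ v, f v = c₀ + ∑ d, v d * c d) : Measurable f := by
  rw [funext hf]
  fun_prop

theorem measurable_iterComp {ι : Type*} [Fintype ι] {g : ℕ → (ι → ℝ) → (ι → ℝ)} {K : ℕ}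
    (hg : ∀ k < K, ∀ d, ∃ (c₀ : ℝ) (c : ι → ℝ), ∀ v, g k v d = c₀ + ∑ d', v d' * c d')
    {k : ℕ} (hk : k ≤ K) : Measurable (iterComp g k) := by
  induction k with
  | zero => exact measurable_id
  | succ k ih =>
    have hgk : Measurable (g k) := measurable_pi_iff.2 fun d => by
      obtain ⟨c₀, c, hc⟩ := hg k (by omega) d
      exact measurable_of_affine hc
    exact hgk.comp (ih (by omega))

/-- Under parallel trends, replacing calendar-time indices by first-period indices in an
iterated surrogate index changes both arms by the same amount. Here `h₁`, `h₀` are the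
surrogate indices of the two arms and `g₁`, `g₀` their pivot indices. -/
theorem iterComp_sub_eq_of_parallel_trends {β : Type*} {T K : ℕ} {t : ℕ → ℕ}
    (htT : ∀ k ≤ K + 1, t k ≤ T) (htmono : ∀ k, k ≤ K → t k < t (k + 1))
    {h₁ h₀ : ℕ → ℕ → β → ℝ} {g₁ g₀ : ℕ → ℕ → β → β}
    (hPT : ∀ u u' δ, 1 ≤ u → u ≤ T → 1 ≤ u' → u' ≤ T → 1 ≤ δ → δ ≤ u → δ ≤ u' → ∀ v₁ v₀,
      h₁ u δ v₁ - h₁ u' δ v₁ = h₀ u δ v₀ - h₀ u' δ v₀)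
    (hExtPT : ∀ (u₀ : ℕ) (us : List ℕ), 1 ≤ u₀ → u₀ ≤ T → (∀ u ∈ us, 1 ≤ u ∧ u ≤ T) →
      us.length + 1 ≤ K → ∀ u u' δ, 1 ≤ u → u ≤ T → 1 ≤ u' → u' ≤ T →
      1 ≤ δ → δ ≤ u → δ ≤ u' → ∀ v₁ v₀,
        h₁ u₀ u₀ (applyChain (fun m => g₁ m m) us (g₁ u δ v₁))
            - h₁ u₀ u₀ (applyChain (fun m => g₁ m m) us (g₁ u' δ v₁))
          = h₀ u₀ u₀ (applyChain (fun m => g₀ m m) us (g₀ u δ v₀))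
            - h₀ u₀ u₀ (applyChain (fun m => g₀ m m) us (g₀ u' δ v₀)))
    (v₁ v₀ : β) :
    h₁ (t (K + 1)) (t (K + 1) - t K)
          (iterComp (fun k => g₁ (t (k + 1)) (t (k + 1) - t k)) K v₁)
        - h₁ (t (K + 1) - t K) (t (K + 1) - t K)
          (iterComp (fun k => g₁ (t (k + 1) - t k) (t (k + 1) - t k)) K v₁)
      = h₀ (t (K + 1)) (t (K + 1) - t K)
          (iterComp (fun k => g₀ (t (k + 1)) (t (k + 1) - t k)) K v₀)
        - h₀ (t (K + 1) - t K) (t (K + 1) - t K)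
          (iterComp (fun k => g₀ (t (k + 1) - t k) (t (k + 1) - t k)) K v₀) := by
  have hlast := htmono K le_rfl
  have hlastT := htT (K + 1) le_rfl
  have main : ∀ j ≤ K, ∃ us : List ℕ, us.length = j ∧ (∀ u ∈ us, 1 ≤ u ∧ u ≤ T) ∧
      (∀ (g : ℕ → ℕ → β → β) v, applyChain (fun m => g m m) us
        (iterComp (fun k => g (t (k + 1) - t k) (t (k + 1) - t k)) (K - j) v)
          = iterComp (fun k => g (t (k + 1) - t k) (t (k + 1) - t k)) K v) ∧
      h₁ (t (K + 1)) (t (K + 1) - t K)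
          (iterComp (fun k => g₁ (t (k + 1)) (t (k + 1) - t k)) K v₁)
        - h₁ (t (K + 1) - t K) (t (K + 1) - t K) (applyChain (fun m => g₁ m m) us
          (iterComp (fun k => g₁ (t (k + 1)) (t (k + 1) - t k)) (K - j) v₁))
      = h₀ (t (K + 1)) (t (K + 1) - t K)
          (iterComp (fun k => g₀ (t (k + 1)) (t (k + 1) - t k)) K v₀)
        - h₀ (t (K + 1) - t K) (t (K + 1) - t K) (applyChain (fun m => g₀ m m) us
          (iterComp (fun k => g₀ (t (k + 1)) (t (k + 1) - t k)) (K - j) v₀)) := by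
    intro j
    induction j with
    | zero =>
      exact fun _ => ⟨[], rfl, by simp, fun _ _ => rfl,
        hPT _ _ _ (by omega) (by omega) (by omega) (by omega) (by omega) (by omega) le_rfl _ _⟩
    | succ j ih =>
      intro hj
      obtain ⟨us, hlen, hus, hchain, heq⟩ := ih (by omega)
      obtain ⟨i, hi⟩ : ∃ i, K - j = i + 1 := ⟨K - j - 1, by omega⟩
      have hi' : K - (j + 1) = i := by omega
      have hit := htmono i (by omega)
      have hiT := htT (i + 1) (by omega)
      rw [hi] at hchain heq
      rw [hi']
      refine ⟨us ++ [t (i + 1) - t i], by simp [hlen], ?_, fun g v => ?_, ?_⟩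
      · intro u hu
        rcases List.mem_append.1 hu with hu | hu
        · exact hus u hu
        · rw [List.mem_singleton.1 hu]
          omega
      · rw [applyChain_concat]
        exact hchain g v
      · rw [applyChain_concat, applyChain_concat]
        have hstep := hExtPT (t (K + 1) - t K) us (by omega) (by omega) hus (by omega)
          (t (i + 1)) (t (i + 1) - t i) (t (i + 1) - t i) (by omega) hiT (by omega) (by omega)
          (by omega) (by omega) le_rfl
          (iterComp (fun k => g₁ (t (k + 1)) (t (k + 1) - t k)) i v₁)
          (iterComp (fun k => g₀ (t (k + 1)) (t (k + 1) - t k)) i v₀)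
        simp only [iterComp] at heq hstep ⊢
        linarith
  obtain ⟨us, -, -, hchain, heq⟩ := main K le_rfl
  rw [Nat.sub_self] at hchain heq
  rw [← hchain g₁, ← hchain g₀]
  exact heq

/-- Theorem 2' (linear surrogate model under parallel trends): under longitudinal
surrogacy at every time in `𝕋`, extended linearity, extended-domain parallel trends,
and extended parallel trends, the average effect of the long-term treatment is
identified by iterating the (affinely extended) pivot indices and applying the
(affinely extended) surrogate index at the end, in expectation over `(S_0, X)`. -/
theorem linear_surrogate_model_parallel_trends
    {Ω : Type*} [MeasurableSpace Ω] (P : Measure Ω) [IsProbabilityMeasure P]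
    {𝕏 : Type*} [Fintype 𝕏] [MeasurableSpace 𝕏] [MeasurableSingletonClass 𝕏]
    (D T_E T_F : ℕ) (hD : 0 < D) (hTE : 0 < T_E) (hTF : 0 < T_F)
    (𝕊 : Finset (Fin D → ℝ))
    (X : Ω → 𝕏) (hX : Measurable X)
    (S : ℕ → Ω → (Fin D → ℝ)) (hSmeas : ∀ t, Measurable (S t))
    (hSmem : ∀ t ω, S t ω ∈ 𝕊)
    (Y : ℕ → Ω → ℝ) (hYmeas : ∀ t, Measurable (Y t)) (hYint : ∀ t, Integrable (Y t) P)
    (A : Ω → Bool) (hA : Measurable A)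
    -- randomized assignment: `A` is independent of `(X, S_0)`
    (hindep : IndepFun (fun ω => (X ω, S 0 ω)) A P)
    -- all conditioning events have positive probability
    (hApos : ∀ a : Bool, P {ω | A ω = a} ≠ 0)
    (hpos : ∀ r, r ≤ T_E + T_F → ∀ s ∈ 𝕊, ∀ (x : 𝕏) (a : Bool),
      P {ω | S r ω = s ∧ X ω = x ∧ A ω = a} ≠ 0)
    -- the pivot times `t 0 = 0 < t 1 < … < t K < t (K+1) = T`
    (K : ℕ) (t : ℕ → ℕ)
    (ht0 : t 0 = 0) (htlast : t (K + 1) = T_E + T_F)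
    (htmono : ∀ k, k ≤ K → t k < t (k + 1))
    -- longitudinal surrogacy at every time `r ∈ 𝕋`
    (hsurr : ∀ k, 1 ≤ k → k ≤ K → ∀ t', t k < t' → t' ≤ T_E + T_F →
      ∀ s ∈ 𝕊, ∀ (x : 𝕏) (a : Bool) (hist : ℕ → (Fin D → ℝ)),
        P {ω | (∀ i < t k, S i ω = hist i) ∧ S (t k) ω = s ∧ X ω = x ∧ A ω = a} ≠ 0 →
        Measure.map (fun ω => (Y t' ω, S t' ω))
            (P[|{ω | (∀ i < t k, S i ω = hist i) ∧ S (t k) ω = s ∧ X ω = x ∧ A ω = a}])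
          = Measure.map (fun ω => (Y t' ω, S t' ω))
            (P[|{ω | S (t k) ω = s ∧ X ω = x ∧ A ω = a}]))
    -- extended linearity: the generalized surrogate index `h^δ_t` and generalized
    -- pivot index `g^δ_t` are affine in the surrogates and agree on `𝕊` with the
    -- corresponding conditional expectations
    (hL : ℕ → ℕ → (Fin D → ℝ) → 𝕏 → Bool → ℝ)
    (gL : ℕ → ℕ → (Fin D → ℝ) → 𝕏 → Bool → (Fin D → ℝ))
    (hLaffine : ∀ u δ (x : 𝕏) (a : Bool), 1 ≤ δ → δ ≤ u → u ≤ T_E + T_F →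
      ∃ (c₀ : ℝ) (c : Fin D → ℝ), ∀ v : Fin D → ℝ,
        hL u δ v x a = c₀ + ∑ d, v d * c d)
    (hLagree : ∀ u δ, 1 ≤ δ → δ ≤ u → u ≤ T_E + T_F → ∀ s ∈ 𝕊, ∀ (x : 𝕏) (a : Bool),
      hL u δ s x a = ∫ ω, Y u ω ∂(P[|{ω | S (u - δ) ω = s ∧ X ω = x ∧ A ω = a}]))
    (hgaffine : ∀ u δ (x : 𝕏) (a : Bool) (d : Fin D), 1 ≤ δ → δ ≤ u → u ≤ T_E + T_F →
      ∃ (c₀ : ℝ) (c : Fin D → ℝ), ∀ v : Fin D → ℝ,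
        gL u δ v x a d = c₀ + ∑ d', v d' * c d')
    (hgagree : ∀ u δ, 1 ≤ δ → δ ≤ u → u ≤ T_E + T_F →
      ∀ s ∈ 𝕊, ∀ (x : 𝕏) (a : Bool) (d : Fin D),
      gL u δ s x a d = ∫ ω, S u ω d ∂(P[|{ω | S (u - δ) ω = s ∧ X ω = x ∧ A ω = a}]))
    -- extended-domain parallel trends (on all of `ℝ^D`, via the affine extensions)
    (hPT : ∀ u u' δ, 1 ≤ u → u ≤ T_E + T_F → 1 ≤ u' → u' ≤ T_E + T_F →
      1 ≤ δ → δ ≤ u → δ ≤ u' → ∀ (v₁ v₀ : Fin D → ℝ) (x : 𝕏),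
        hL u δ v₁ x true - hL u' δ v₁ x true = hL u δ v₀ x false - hL u' δ v₀ x false)
    -- extended parallel trends: for `j ∈ {0,…,K-1}` and times `u₀, u₁, …, u_j`,
    -- with `Φ_a(v) = h_{u₀}(g_{u₁}(⋯ g_{u_j}(v, x, a) ⋯, x, a), x, a)`
    (hExtPT : ∀ (u₀ : ℕ) (us : List ℕ), 1 ≤ u₀ → u₀ ≤ T_E + T_F →
      (∀ u ∈ us, 1 ≤ u ∧ u ≤ T_E + T_F) → us.length + 1 ≤ K →
      ∀ u u' δ, 1 ≤ u → u ≤ T_E + T_F → 1 ≤ u' → u' ≤ T_E + T_F →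
        1 ≤ δ → δ ≤ u → δ ≤ u' → ∀ (v₁ v₀ : Fin D → ℝ) (x : 𝕏),
        hL u₀ u₀ (applyChain (fun m v => gL m m v x true) us (gL u δ v₁ x true)) x true
            - hL u₀ u₀ (applyChain (fun m v => gL m m v x true) us (gL u' δ v₁ x true)) x true
          = hL u₀ u₀ (applyChain (fun m v => gL m m v x false) us (gL u δ v₀ x false)) x false
            - hL u₀ u₀ (applyChain (fun m v => gL m m v x false) us (gL u' δ v₀ x false)) x false) :
    (∫ ω, Y (T_E + T_F) ω ∂(P[|{ω | A ω = true}]))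
      - (∫ ω, Y (T_E + T_F) ω ∂(P[|{ω | A ω = false}]))
    = (∫ ω, hL (t (K + 1) - t K) (t (K + 1) - t K)
          (Nat.rec (motive := fun _ => Fin D → ℝ) (S 0 ω)
            (fun k ih => gL (t (k + 1) - t k) (t (k + 1) - t k) ih (X ω) true) K)
          (X ω) true ∂P)
      - ∫ ω, hL (t (K + 1) - t K) (t (K + 1) - t K)
          (Nat.rec (motive := fun _ => Fin D → ℝ) (S 0 ω)
            (fun k ih => gL (t (k + 1) - t k) (t (k + 1) - t k) ih (X ω) false) K)
          (X ω) false ∂P := by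
  have htT : ∀ k ≤ K + 1, t k ≤ T_E + T_F := by
    rw [← htlast]
    intro k hk
    induction hn : K + 1 - k generalizing k with
    | zero => rw [show k = K + 1 by omega]
    | succ n ih => exact (htmono k (by omega)).le.trans (ih (k + 1) (by omega) (by omega))
  have hstep : ∀ k ≤ K, 1 ≤ t (k + 1) - t k ∧ t (k + 1) - t k ≤ t (k + 1) ∧
      t (k + 1) - t k ≤ T_E + T_F ∧ t (k + 1) - (t (k + 1) - t k) = t k := by
    intro k hk
    have := htmono k hk
    have := htT (k + 1) (by omega)
    omega
  have hSint : ∀ r d, Integrable (fun ω => S r ω d) P := by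
    intro r d
    refine Integrable.of_bound (by fun_prop) (∑ s ∈ 𝕊, |s d|) (.of_forall fun ω => ?_)
    exact Finset.single_le_sum (f := fun s : Fin D → ℝ => |s d|) (fun s _ => abs_nonneg _)
      (hSmem r ω)
  obtain ⟨ω₀⟩ : Nonempty Ω := nonempty_of_isProbabilityMeasure P
  have hBpos : ∀ x a, P {ω | X ω = x ∧ A ω = a} ≠ 0 := fun x a h =>
    hpos 0 (Nat.zero_le _) _ (hSmem 0 ω₀) x a (measure_mono_null (fun ω hω => hω.2) h)
  have hBmeas : ∀ x a, MeasurableSet {ω | X ω = x ∧ A ω = a} := fun x a =>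
    (hX (measurableSet_singleton x)).inter (hA (measurableSet_singleton a))
  have hgaff : ∀ x a, ∀ k < K, ∀ d, ∃ (c₀ : ℝ) (c : Fin D → ℝ), ∀ v,
      gL (t (k + 1) - t k) (t (k + 1) - t k) v x a d = c₀ + ∑ d', v d' * c d' :=
    fun x a k hk d => hgaffine _ _ x a d (hstep k hk.le).1 le_rfl (hstep k hk.le).2.2.1
  obtain ⟨hΔ1, hΔ2, hΔ3, hΔ4⟩ := hstep K le_rfl
  -- the identified functional, and the same functional with calendar-time indices
  set R : Bool → 𝕏 → (Fin D → ℝ) → ℝ := fun a x v =>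
    hL (t (K + 1) - t K) (t (K + 1) - t K)
      (iterComp (fun k v => gL (t (k + 1) - t k) (t (k + 1) - t k) v x a) K v) x a
  set H : Bool → 𝕏 → (Fin D → ℝ) → ℝ := fun a x v =>
    hL (t (K + 1)) (t (K + 1) - t K)
      (iterComp (fun k v => gL (t (k + 1)) (t (k + 1) - t k) v x a) K v) x a
  have hHR : ∀ x v₁ v₀, H true x v₁ - R true x v₁ = H false x v₀ - R false x v₀ :=
    fun x v₁ v₀ => iterComp_sub_eq_of_parallel_trends htT htmono
      (h₁ := fun u δ v => hL u δ v x true) (h₀ := fun u δ v => hL u δ v x false)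
      (g₁ := fun u δ v => gL u δ v x true) (g₀ := fun u δ v => gL u δ v x false)
      (fun u u' δ h1 h2 h3 h4 h5 h6 h7 v₁ v₀ => hPT u u' δ h1 h2 h3 h4 h5 h6 h7 v₁ v₀ x)
      (fun u₀ us h1 h2 h3 h4 u u' δ k1 k2 k3 k4 k5 k6 k7 v₁ v₀ =>
        hExtPT u₀ us h1 h2 h3 h4 u u' δ k1 k2 k3 k4 k5 k6 k7 v₁ v₀ x) v₁ v₀
  have hRint : ∀ a x (μ : Measure Ω) [IsProbabilityMeasure μ],
      (∀ d, Integrable (fun ω => S 0 ω d) μ) → Integrable (fun ω => R a x (S 0 ω)) μ ∧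
        ∫ ω, R a x (S 0 ω) ∂μ = R a x (fun d => ∫ ω, S 0 ω d ∂μ) := by
    intro a x μ _ hV
    obtain ⟨h1, h2⟩ := integrable_and_integral_iterComp (hgaff x a) hV le_rfl
    obtain ⟨c₀, c, hc⟩ := hLaffine _ _ x a hΔ1 le_rfl hΔ3
    have h3 := integrable_and_integral_affine hc h1
    rw [h2] at h3
    exact h3
  have hRmeas : ∀ a x, Measurable (R a x) := by
    intro a x
    obtain ⟨c₀, c, hc⟩ := hLaffine _ _ x a hΔ1 le_rfl hΔ3
    exact (measurable_of_affine hc).comp (measurable_iterComp (hgaff x a) le_rfl)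
  have hRmeas' : ∀ a, Measurable (fun p : 𝕏 × (Fin D → ℝ) => R a p.1 p.2) := fun a =>
    measurable_from_prod_countable_right (hRmeas a)
  have hWmeas : ∀ a, Measurable (fun ω => R a (X ω) (S 0 ω)) := fun a =>
    (hRmeas' a).comp (hX.prodMk (hSmeas 0))
  have hWint : ∀ a, Integrable (fun ω => R a (X ω) (S 0 ω)) P := by
    intro a
    refine Integrable.mono' (g := fun ω => ∑ x, |R a x (S 0 ω)|)
      (integrable_finsetSum _ fun x _ => (hRint a x P (hSint 0)).1.abs)
      (hWmeas a).aestronglyMeasurable (.of_forall fun ω => ?_)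
    exact Finset.single_le_sum (f := fun x => |R a x (S 0 ω)|) (fun x _ => abs_nonneg _)
      (Finset.mem_univ (X ω))
  have hH_eq : ∀ x a, ∫ ω, Y (T_E + T_F) ω ∂(P[|{ω | X ω = x ∧ A ω = a}])
      = H a x (fun d => ∫ ω, S 0 ω d ∂(P[|{ω | X ω = x ∧ A ω = a}])) := by
    intro x a
    have : IsProbabilityMeasure (P[|{ω | X ω = x ∧ A ω = a}]) :=
      cond_isProbabilityMeasure (hBpos x a)
    have hmean : ∀ k ≤ K, (fun d => ∫ ω, S (t k) ω d ∂(P[|{ω | X ω = x ∧ A ω = a}]))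
        = iterComp (fun k v => gL (t (k + 1)) (t (k + 1) - t k) v x a) k
          (fun d => ∫ ω, S 0 ω d ∂(P[|{ω | X ω = x ∧ A ω = a}])) := by
      intro k hk
      induction k with
      | zero => rw [ht0]; rfl
      | succ k ih =>
        obtain ⟨e1, e2, -, e4⟩ := hstep k (by omega)
        have e5 := htT (k + 1) (by omega)
        funext d
        rw [integral_cond_eq_integral_comp (hSint _ d) (hSmeas (t k)) (hSmem (t k))
          (hBmeas x a) (L := fun s => gL (t (k + 1)) (t (k + 1) - t k) s x a d)
          (fun s hs => by rw [hgagree _ _ e1 e2 e5 s hs, e4]; rfl)]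
        obtain ⟨c₀, c, hc⟩ := hgaffine _ _ x a d e1 e2 e5
        rw [(integrable_and_integral_affine hc fun d => (hSint _ d).cond (hBpos x a)).2,
          ih (by omega)]
        rfl
    have e5 := htT (K + 1) le_rfl
    rw [← htlast, integral_cond_eq_integral_comp (hYint _) (hSmeas (t K)) (hSmem (t K))
      (hBmeas x a) (L := fun s => hL (t (K + 1)) (t (K + 1) - t K) s x a)
      (fun s hs => by rw [hLagree _ _ hΔ1 hΔ2 e5 s hs, hΔ4]; rfl)]
    obtain ⟨c₀, c, hc⟩ := hLaffine _ _ x a hΔ1 hΔ2 e5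
    rw [(integrable_and_integral_affine hc fun d => (hSint _ d).cond (hBpos x a)).2,
      hmean K le_rfl]
  have hR_eq : ∀ x a, ∫ ω, R a (X ω) (S 0 ω) ∂(P[|{ω | X ω = x ∧ A ω = a}])
      = R a x (fun d => ∫ ω, S 0 ω d ∂(P[|{ω | X ω = x ∧ A ω = a}])) := by
    intro x a
    have : IsProbabilityMeasure (P[|{ω | X ω = x ∧ A ω = a}]) :=
      cond_isProbabilityMeasure (hBpos x a)
    rw [← (hRint a x _ fun d => (hSint 0 d).cond (hBpos x a)).2]
    refine integral_congr_ae ?_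
    filter_upwards [ae_cond_mem (hBmeas x a)] with ω hω
    rw [hω.1]
  have harm : ∀ a, ∫ ω, Y (T_E + T_F) ω ∂(P[|{ω | A ω = a}]) - ∫ ω, R a (X ω) (S 0 ω) ∂P
      = ∫ ω, (fun x => H true x 0 - R true x 0) (X ω) ∂P := by
    intro a
    have hAmeas : MeasurableSet {ω | A ω = a} := hA (measurableSet_singleton a)
    have htrend : ∫ ω, (fun x => H true x 0 - R true x 0) (X ω) ∂(P[|{ω | A ω = a}])
        = ∫ ω, (fun x => H true x 0 - R true x 0) (X ω) ∂P :=
      integral_cond_eq_integral_of_indepFun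
        ((measurable_of_finite (fun x => H true x 0 - R true x 0)).comp hX) hA
        (hindep.comp ((measurable_of_finite (fun x => H true x 0 - R true x 0)).comp
          measurable_fst) measurable_id) (hApos a)
    rw [← htrend, ← integral_cond_eq_integral_of_indepFun (hWmeas a) hA
        (hindep.comp (hRmeas' a) measurable_id) (hApos a),
      ← integral_sub ((hYint _).cond (hApos a)) ((hWint a).cond (hApos a))]
    refine integral_cond_eq_integral_comp (L := fun x => H true x 0 - R true x 0)
      ((hYint (T_E + T_F)).sub (hWint a)) hX (fun ω => Finset.mem_univ _) hAmeas fun x _ => ?_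
    change _ = ∫ ω, (Y (T_E + T_F) ω - R a (X ω) (S 0 ω)) ∂(P[|{ω | X ω = x ∧ A ω = a}])
    rw [integral_sub ((hYint _).cond (hBpos x a)) ((hWint a).cond (hBpos x a)), hH_eq, hR_eq]
    cases a
    · exact hHR x _ _
    · exact (hHR x 0 0).trans (hHR x _ 0).symm
  have h1 := harm true
  have h0 := harm false
  change _ = ∫ ω, R true (X ω) (S 0 ω) ∂P - ∫ ω, R false (X ω) (S 0 ω) ∂P
  linarith
end

section
/- Let 𝕋 = {t_1 < t_2 < ⋯ < t_K} ⊆ {1,…,T} and suppose longitudinal surrogacy holds at every time r ∈ 𝕋. Then for all s_K ∈ 𝕊, s₀ ∈ 𝕊, x ∈ 𝕏, a ∈ {0,1}, the conditional distribution of S_{t_K} factorizes through the intermediate surrogates: P(S_{t_K} = s_K | A = a, X = x, S_0 = s₀) = Σ_{s_1,…,s_{K−1} ∈ 𝕊} P(S_{t_1} = s_1 | S_0 = s₀, X = x, A = a) · Π_{k=2}^{K} P(S_{t_k} = s_k | S_{t_{k−1}} = s_{k−1}, X = x, A = a). -/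
open MeasureTheory ProbabilityTheory

/-- The sequence `σ 0, …, σ (K'-1), s_K, s_K, …` of intermediate surrogate values,
indexed by `ℕ`: for `j < K'` it is `σ j`, and `s_K` from `j = K'` onwards. -/
def midSeq {α : Type*} (sK : α) {K' : ℕ} (σ : Fin K' → α) : ℕ → α :=
  fun j => if h : j < K' then σ ⟨j, h⟩ else sK

theorem midSeq_of_lt {α : Type*} (b : α) {n : ℕ} (σ : Fin n → α) {j : ℕ} (h : j < n) :
    midSeq b σ j = σ ⟨j, h⟩ :=
  dif_pos h

theorem midSeq_of_le {α : Type*} (b : α) {n : ℕ} (σ : Fin n → α) {j : ℕ} (h : n ≤ j) :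
    midSeq b σ j = b :=
  dif_neg h.not_gt

theorem midSeq_snoc {α : Type*} (b c : α) {n : ℕ} (σ : Fin n → α) {j : ℕ} (h : j ≤ n) :
    midSeq b (Fin.snoc σ c : Fin (n + 1) → α) j = midSeq c σ j := by
  rw [midSeq_of_lt _ _ (Nat.lt_succ_of_le h)]
  rcases h.lt_or_eq with h' | rfl
  · rw [midSeq_of_lt _ _ h']
    exact Fin.snoc_castSucc (α := fun _ => α) c σ ⟨j, h'⟩
  · rw [midSeq_of_le _ _ le_rfl]
    exact Fin.snoc_last (α := fun _ => α) c σ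

/-- A sum over sequences of length `n + 1` is an iterated sum over the last entry and the
initial sequence. -/
theorem sum_piFinset_snoc {α M : Type*} [AddCommMonoid M] (s : Finset α) (n : ℕ)
    (F : (Fin (n + 1) → α) → M) :
    ∑ σ ∈ Fintype.piFinset (fun _ : Fin (n + 1) => s), F σ
      = ∑ c ∈ s, ∑ σ ∈ Fintype.piFinset (fun _ : Fin n => s), F (Fin.snoc σ c) := by
  rw [← Finset.sum_product']
  refine Finset.sum_nbij' (fun σ => (σ (Fin.last n), Fin.init σ))
    (fun p => (Fin.snoc p.2 p.1 : Fin (n + 1) → α)) ?_ ?_ ?_ ?_ ?_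
  · intro σ hσ
    simp only [Fintype.mem_piFinset] at hσ
    simp [Fin.init, hσ]
  · rintro ⟨c, σ⟩ h
    simp only [Finset.mem_product, Fintype.mem_piFinset] at h
    simp only [Fintype.mem_piFinset]
    intro i
    refine Fin.lastCases ?_ (fun i => ?_) i
    · simpa using h.1
    · simpa using h.2 i
  · intro σ _
    simp
  · rintro ⟨c, σ⟩ _
    simp
  · intro σ _
    simp

/-- A marginal obtained by iterating transition kernels is a sum over paths. -/
theorem marginal_eq_sum_paths {α R : Type*} [CommSemiring R] (s : Finset α) (f : ℕ → α → R)
    (q : ℕ → α → α → R) (n : ℕ)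
    (hstep : ∀ k < n, ∀ c ∈ s, f (k + 1) c = ∑ b ∈ s, f k b * q k b c) :
    ∀ c ∈ s, f n c = ∑ σ ∈ Fintype.piFinset (fun _ : Fin n => s),
      f 0 (midSeq c σ 0) * ∏ k ∈ Finset.range n, q k (midSeq c σ k) (midSeq c σ (k + 1)) := by
  induction n with
  | zero =>
    intro c _
    simp [midSeq_of_le]
  | succ n ih =>
    intro c hc
    rw [hstep n n.lt_succ_self c hc, sum_piFinset_snoc]
    refine Finset.sum_congr rfl fun b hb => ?_
    rw [ih (fun k hk => hstep k (hk.trans n.lt_succ_self)) b hb, Finset.sum_mul]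
    refine Finset.sum_congr rfl fun σ _ => ?_
    rw [Finset.prod_range_succ, midSeq_snoc _ _ _ (Nat.zero_le n), midSeq_snoc _ _ _ le_rfl,
      midSeq_of_le c _ le_rfl, midSeq_of_le b _ le_rfl, mul_assoc]
    congr 2
    refine Finset.prod_congr rfl fun k hk => ?_
    have hk := Finset.mem_range.1 hk
    rw [midSeq_snoc _ _ _ hk.le, midSeq_snoc _ _ _ hk]

/-- The measure of a set is the sum of the measures of its slices along a function with values
in a finite set. -/
theorem measureReal_eq_sum_fiber {Ω α : Type*} [MeasurableSpace Ω] [MeasurableSpace α]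
    [MeasurableSingletonClass α] (μ : Measure Ω) [IsFiniteMeasure μ] (s : Finset α)
    {f : Ω → α} (hf : Measurable f) (hfs : ∀ ω, f ω ∈ s) {G : Set Ω} (hG : MeasurableSet G) :
    μ.real G = ∑ c ∈ s, μ.real (G ∩ {ω | f ω = c}) := by
  rw [← measureReal_biUnion_finset]
  · congr 1
    ext ω
    simp [hfs ω]
  · intro b _ c _ hbc
    refine Set.disjoint_left.2 ?_
    rintro ω ⟨_, hb⟩ ⟨_, hc⟩
    exact hbc (hb.symm.trans hc)
  · exact fun c _ => hG.inter (hf (measurableSet_singleton c))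

/-- The conditional probability of `C` given `B` is `P (B ∩ C) / P B`. -/
theorem cond_measureReal_apply {Ω : Type*} [MeasurableSpace Ω] (P : Measure Ω) {B : Set Ω}
    (hB : MeasurableSet B) (C : Set Ω) :
    (P[|B]).real C = (P.real B)⁻¹ * P.real (B ∩ C) := by
  simp [measureReal_def, cond_apply hB]

/-- If every nonnull full-history refinement of `B` gives `C` the same conditional probability
as `B`, then so does conditioning on the initial value only. -/
theorem measureReal_inter_eq_mul_cond_of_history {Ω α : Type*} [MeasurableSpace Ω]
    [MeasurableSpace α] [MeasurableSingletonClass α] (P : Measure Ω)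
    [IsFiniteMeasure P] (s : Finset α) (S : ℕ → Ω → α) (hS : ∀ i, Measurable (S i))
    (hSs : ∀ i ω, S i ω ∈ s) {n : ℕ} (hn : 0 < n) {B C : Set Ω} (hB : MeasurableSet B)
    (hC : MeasurableSet C)
    (h : ∀ hist : ℕ → α, P ({ω | ∀ i < n, S i ω = hist i} ∩ B) ≠ 0 →
      (P[|{ω | ∀ i < n, S i ω = hist i} ∩ B]).real C = (P[|B]).real C) (s₀ : α) :
    P.real ({ω | S 0 ω = s₀} ∩ B ∩ C) = P.real ({ω | S 0 ω = s₀} ∩ B) * (P[|B]).real C := by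
  have hH : Measurable fun ω (i : Fin n) => S i ω := measurable_pi_lambda _ fun i => hS i
  have hE : MeasurableSet ({ω | S 0 ω = s₀} ∩ B) :=
    (hS 0 (measurableSet_singleton s₀)).inter hB
  have hHs : ∀ ω, (fun i : Fin n => S i ω) ∈ Fintype.piFinset fun _ : Fin n => s :=
    fun ω => Fintype.mem_piFinset.2 fun i => hSs i ω
  rw [measureReal_eq_sum_fiber P _ hH hHs (hE.inter hC), measureReal_eq_sum_fiber P _ hH hHs hE,
    Finset.sum_mul]
  refine Finset.sum_congr rfl fun g _ => ?_
  by_cases hg : g ⟨0, hn⟩ = s₀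
  · set hist : ℕ → α := midSeq s₀ g
    have hset : {ω | S 0 ω = s₀} ∩ B ∩ {ω | (fun i : Fin n => S i ω) = g}
        = {ω | ∀ i < n, S i ω = hist i} ∩ B := by
      ext ω
      simp only [Set.mem_inter_iff, Set.mem_ofPred_eq, funext_iff]
      constructor
      · rintro ⟨⟨_, hb⟩, hω⟩
        exact ⟨fun i hi => (hω ⟨i, hi⟩).trans (midSeq_of_lt _ _ hi).symm, hb⟩
      · rintro ⟨hω, hb⟩
        have hω' : ∀ i : Fin n, S i ω = g i :=
          fun i => (hω i i.2).trans (midSeq_of_lt _ _ i.2)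
        exact ⟨⟨(hω' ⟨0, hn⟩).trans hg, hb⟩, hω'⟩
    have hm : MeasurableSet ({ω | ∀ i < n, S i ω = hist i} ∩ B) := by
      rw [← hset]
      exact hE.inter (hH (measurableSet_singleton g))
    rw [Set.inter_right_comm _ C, hset]
    by_cases h0 : P ({ω | ∀ i < n, S i ω = hist i} ∩ B) = 0
    · rw [measureReal_def, measureReal_def, h0, measure_mono_null Set.inter_subset_left h0]
      simp
    · rw [← h hist h0, cond_measureReal_apply P hm, mul_inv_cancel_left₀]
      rwa [measureReal_ne_zero_iff]
  · have hset : {ω | S 0 ω = s₀} ∩ B ∩ {ω | (fun i : Fin n => S i ω) = g} = ∅ := by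
      refine Set.eq_empty_of_forall_notMem ?_
      rintro ω ⟨⟨h0, _⟩, hω⟩
      exact hg ((congrFun hω ⟨0, hn⟩).symm.trans h0)
    rw [Set.inter_right_comm _ C, hset]
    simp

/-- Under longitudinal surrogacy at every time in `𝕋 = {t 1 < … < t K}`, the
conditional distribution of `S_{t_K}` given `(A, X, S_0)` factorizes through the
intermediate surrogates. -/
theorem surrogate_distribution_factorizes
    {Ω : Type*} [MeasurableSpace Ω] (P : Measure Ω) [IsProbabilityMeasure P]
    {𝕏 : Type*} [Fintype 𝕏] [MeasurableSpace 𝕏] [MeasurableSingletonClass 𝕏]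
    (D T_E T_F : ℕ) (hD : 0 < D) (hTE : 0 < T_E) (hTF : 0 < T_F)
    (𝕊 : Finset (Fin D → ℝ))
    (X : Ω → 𝕏) (hX : Measurable X)
    (S : ℕ → Ω → (Fin D → ℝ)) (hSmeas : ∀ t, Measurable (S t))
    (hSmem : ∀ t ω, S t ω ∈ 𝕊)
    (Y : ℕ → Ω → ℝ) (hYmeas : ∀ t, Measurable (Y t)) (hYint : ∀ t, Integrable (Y t) P)
    (A : Ω → Bool) (hA : Measurable A)
    -- all conditioning events have positive probability
    (hpos : ∀ r, r ≤ T_E + T_F → ∀ s ∈ 𝕊, ∀ (x : 𝕏) (a : Bool),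
      P {ω | S r ω = s ∧ X ω = x ∧ A ω = a} ≠ 0)
    (hpos' : ∀ s₀ ∈ 𝕊, ∀ (x : 𝕏) (a : Bool),
      P {ω | A ω = a ∧ X ω = x ∧ S 0 ω = s₀} ≠ 0)
    -- the pivot times `1 ≤ t 1 < t 2 < … < t K ≤ T`
    (K : ℕ) (hK : 1 ≤ K) (t : ℕ → ℕ)
    (ht1 : 1 ≤ t 1) (htK : t K ≤ T_E + T_F)
    (htmono : ∀ k, 1 ≤ k → k < K → t k < t (k + 1))
    -- longitudinal surrogacy at every time `r ∈ 𝕋`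
    (hsurr : ∀ k, 1 ≤ k → k ≤ K → ∀ t', t k < t' → t' ≤ T_E + T_F →
      ∀ s ∈ 𝕊, ∀ (x : 𝕏) (a : Bool) (hist : ℕ → (Fin D → ℝ)),
        P {ω | (∀ i < t k, S i ω = hist i) ∧ S (t k) ω = s ∧ X ω = x ∧ A ω = a} ≠ 0 →
        Measure.map (fun ω => (Y t' ω, S t' ω))
            (P[|{ω | (∀ i < t k, S i ω = hist i) ∧ S (t k) ω = s ∧ X ω = x ∧ A ω = a}])
          = Measure.map (fun ω => (Y t' ω, S t' ω))
            (P[|{ω | S (t k) ω = s ∧ X ω = x ∧ A ω = a}])) :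
    ∀ sK ∈ 𝕊, ∀ s₀ ∈ 𝕊, ∀ (x : 𝕏) (a : Bool),
      ((P[|{ω | A ω = a ∧ X ω = x ∧ S 0 ω = s₀}]) {ω | S (t K) ω = sK}).toReal
      = ∑ σ ∈ Fintype.piFinset (fun _ : Fin (K - 1) => 𝕊),
          ((P[|{ω | S 0 ω = s₀ ∧ X ω = x ∧ A ω = a}]) {ω | S (t 1) ω = midSeq sK σ 0}).toReal
            * ∏ k ∈ Finset.range (K - 1),
                ((P[|{ω | S (t (k + 1)) ω = midSeq sK σ k ∧ X ω = x ∧ A ω = a}])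
                  {ω | S (t (k + 2)) ω = midSeq sK σ (k + 1)}).toReal := by
  intro sK hsK s₀ _ x a
  obtain ⟨n, rfl⟩ : ∃ n, K = n + 1 := ⟨K - 1, by omega⟩
  have ht_bounds : ∀ k, 1 ≤ k → k ≤ n + 1 → 1 ≤ t k ∧ t k ≤ t (n + 1) := by
    have hle : ∀ i j, 1 ≤ i → i ≤ j → j ≤ n + 1 → t i ≤ t j := by
      intro i j hi hij
      induction j, hij using Nat.le_induction with
      | base => exact fun _ => le_rfl
      | succ j hij ih =>
        exact fun hj => (ih (by omega)).trans (htmono j (by omega) (by omega)).le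
    exact fun k h1 hk => ⟨ht1.trans (hle 1 k le_rfl h1 hk), hle k (n + 1) h1 hk le_rfl⟩
  have hS : ∀ i s, MeasurableSet {ω | S i ω = s} :=
    fun i s => hSmeas i (measurableSet_singleton s)
  have hXA : MeasurableSet {ω | X ω = x ∧ A ω = a} :=
    (hX (measurableSet_singleton x)).inter (hA (measurableSet_singleton a))
  have hE : MeasurableSet {ω | S 0 ω = s₀ ∧ X ω = x ∧ A ω = a} := (hS 0 s₀).inter hXA
  have hEeq : {ω | A ω = a ∧ X ω = x ∧ S 0 ω = s₀} = {ω | S 0 ω = s₀ ∧ X ω = x ∧ A ω = a} := by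
    ext ω
    simp only [Set.mem_ofPred_eq]
    tauto
  rw [hEeq]
  refine marginal_eq_sum_paths 𝕊
    (fun k s => ((P[|{ω | S 0 ω = s₀ ∧ X ω = x ∧ A ω = a}]) {ω | S (t (k + 1)) ω = s}).toReal)
    (fun k b c => ((P[|{ω | S (t (k + 1)) ω = b ∧ X ω = x ∧ A ω = a}])
      {ω | S (t (k + 2)) ω = c}).toReal) n ?_ sK hsK
  intro k hk c _
  simp only [← measureReal_def]
  rw [measureReal_eq_sum_fiber _ 𝕊 (hSmeas (t (k + 1))) (hSmem _) (hS _ c)]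
  refine Finset.sum_congr rfl fun b hb => ?_
  have hB : MeasurableSet {ω | S (t (k + 1)) ω = b ∧ X ω = x ∧ A ω = a} := (hS _ b).inter hXA
  have key := measureReal_inter_eq_mul_cond_of_history P 𝕊 S hSmeas hSmem
    (ht_bounds (k + 1) (by omega) (by omega)).1 hB (hS (t (k + 2)) c) (fun hist h0 => by
      have := congrArg (fun ν => ν.real (Set.univ ×ˢ {c}))
        (hsurr (k + 1) (by omega) (by omega) (t (k + 2)) (htmono (k + 1) (by omega) (by omega))
          ((ht_bounds (k + 2) (by omega) (by omega)).2.trans htK) b hb x a hist h0)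
      beta_reduce at this
      rw [map_measureReal_apply ((hYmeas _).prodMk (hSmeas _))
          (MeasurableSet.univ.prod (measurableSet_singleton c)),
        map_measureReal_apply ((hYmeas _).prodMk (hSmeas _))
          (MeasurableSet.univ.prod (measurableSet_singleton c))] at this
      simpa [Set.preimage, Set.ofPred_and] using this) s₀
  rw [cond_measureReal_apply P hE, cond_measureReal_apply P hE, mul_assoc]
  congr 1
  have hset : {ω | S 0 ω = s₀} ∩ {ω | S (t (k + 1)) ω = b ∧ X ω = x ∧ A ω = a}
      = {ω | S 0 ω = s₀ ∧ X ω = x ∧ A ω = a} ∩ {ω | S (t (k + 1)) ω = b} := by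
    ext ω
    simp only [Set.mem_inter_iff, Set.mem_ofPred_eq]
    tauto
  rw [hset, Set.inter_right_comm, Set.inter_assoc] at key
  exact key
end
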